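/- Let Φ : P_5 → P_5 be the 𝔽₂-linear map sending f to x_1x_2x_3x_4x_5·f². For every integer s ≥ 3, the set of classes {[Φ^{s−2}(x)] : x an admissible monomial of degree 67 in P_5} is a basis of the 𝔽₂-vector space (QP_5)_{5(2^s−1)+13·2^s}. -/

import Mathlib

open MvPolynomial

noncomputable section

/-- `P n` is the polynomial algebra `𝔽₂[x_1, …, x_n]`. -/
abbrev P (n : ℕ) : Type := MvPolynomial (Fin n) (ZMod 2)

/-- The total Steenrod square: the `𝔽₂`-algebra endomorphism of `P n`
with `Sq (x_j) = x_j + x_j ^ 2`. -/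
def SqT (n : ℕ) : P n →ₐ[ZMod 2] P n := aeval fun j => X j + X j ^ 2

/-- `u` is hit (in degree `d`): `u = ∑_{i ≥ 1} Sq^i (f i)` where `f i` is homogeneous
of degree `d - i`; here `Sq^i (f i)` is the degree-`d` homogeneous component of
`Sq (f i)`. -/
def IsHit (n d : ℕ) (u : P n) : Prop :=
  ∃ f : ℕ → P n,
    (∀ i, f i ∈ homogeneousSubmodule (Fin n) (ZMod 2) (d - i)) ∧
    u = ∑ i ∈ Finset.Icc 1 d, homogeneousComponent d (SqT n (f i))

/-- The homogeneous part `(P_n)_d`. -/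
abbrev homSub (n d : ℕ) : Submodule (ZMod 2) (P n) := homogeneousSubmodule (Fin n) (ZMod 2) d

/-- The subspace of hit elements of degree `d` (the span of the set of hit elements;
this set is already closed under addition, so this is just the set of hit elements). -/
def hitSub (n d : ℕ) : Submodule (ZMod 2) (P n) := Submodule.span (ZMod 2) {u | IsHit n d u}

/-- The cohit space `(QP_n)_d = (P_n)_d / (A⁺P_n)_d`. -/
abbrev QP (n d : ℕ) : Type :=
  ↥(homSub n d) ⧸ (hitSub n d).comap (homSub n d).subtype

/-- The class `[f]` in `(QP_n)_d` of a polynomial `f` (via its degree-`d` homogeneous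
component; for `f` homogeneous of degree `d` this is the class of `f` itself). -/
def cls (n d : ℕ) (f : P n) : QP n d :=
  Submodule.Quotient.mk
    ⟨homogeneousComponent d f,
      (mem_homogeneousSubmodule _ _).2 (homogeneousComponent_isHomogeneous d f)⟩

/-- The monomial `x^a = x_1^{a_1} ⋯ x_n^{a_n}`. -/
def mono {n : ℕ} (a : Fin n →₀ ℕ) : P n := monomial a 1

/-- The (total) degree of the monomial with exponent vector `a`. -/
def degA {n : ℕ} (a : Fin n →₀ ℕ) : ℕ := ∑ i, a i

/-- The weight vector: `wVec a t = ω_{t+1}(x^a) = ∑_j α_t(a_j)`. -/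
def wVec {n : ℕ} (a : Fin n →₀ ℕ) : ℕ → ℕ :=
  fun t => ∑ j, if Nat.testBit (a j) t then 1 else 0

/-- Left lexicographic (strict) order on sequences. -/
def lexLtN (f g : ℕ → ℕ) : Prop := ∃ i, (∀ j, j < i → f j = g j) ∧ f i < g i

/-- Left lexicographic (strict) order on exponent vectors. -/
def lexLtS {n : ℕ} (a b : Fin n →₀ ℕ) : Prop :=
  ∃ i : Fin n, (∀ j, j < i → a j = b j) ∧ a i < b i

/-- The order on monomials: `u < v` iff `ω(u) < ω(v)` lexicographically, or
`ω(u) = ω(v)` and `σ(u) < σ(v)` lexicographically. -/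
def monLt {n : ℕ} (a b : Fin n →₀ ℕ) : Prop :=
  lexLtN (wVec a) (wVec b) ∨ (wVec a = wVec b ∧ lexLtS a b)

/-- A monomial is admissible iff it is not inadmissible, i.e. there is no finite set of
monomials of the same degree, all smaller than it, such that subtracting their sum
yields a hit polynomial. -/
def Admissible {n : ℕ} (a : Fin n →₀ ℕ) : Prop :=
  ¬ ∃ S : Finset (Fin n →₀ ℕ),
      (∀ b ∈ S, degA b = degA a ∧ monLt b a) ∧
      IsHit n (degA a) (mono a - ∑ b ∈ S, mono b)

/-- `P_n^0`: the span of the monomials in which some variable has exponent `0`. -/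
def PzeroSub (n : ℕ) : Submodule (ZMod 2) (P n) :=
  Submodule.span (ZMod 2) {x : P n | ∃ a : Fin n →₀ ℕ, (∃ i, a i = 0) ∧ x = mono a}

/-- `P_n^+`: the span of the monomials in which every variable occurs. -/
def PplusSub (n : ℕ) : Submodule (ZMod 2) (P n) :=
  Submodule.span (ZMod 2) {x : P n | ∃ a : Fin n →₀ ℕ, (∀ i, 0 < a i) ∧ x = mono a}

/-- `(QP_n^0)_d`: the image of `(P_n^0)_d` in `(QP_n)_d`. -/
def Qzero (n d : ℕ) : Submodule (ZMod 2) (QP n d) :=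
  (((PzeroSub n).comap (homSub n d).subtype)).map
    ((hitSub n d).comap (homSub n d).subtype).mkQ

/-- `(QP_n^+)_d`: the image of `(P_n^+)_d` in `(QP_n)_d`. -/
def Qplus (n d : ℕ) : Submodule (ZMod 2) (QP n d) :=
  (((PplusSub n).comap (homSub n d).subtype)).map
    ((hitSub n d).comap (homSub n d).subtype).mkQ

/-- Kameko-type map `S_5 : P_5 → P_5`, the `𝔽₂`-linear map with
`S_5(x_1x_2x_3x_4x_5 · y²) = y` on monomials of that form and `S_5 = 0` on all
other monomials. -/
def S5 : P 5 →ₗ[ZMod 2] P 5 :=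
  (basisMonomials (Fin 5) (ZMod 2)).constr (ZMod 2) fun a =>
    if ∀ i, Odd (a i) then mono (Finsupp.equivFunOnFinite.symm fun i => a i / 2) else 0

/-- `Φ(f) = x_1x_2x_3x_4x_5 · f²`. -/
def Phi (f : P 5) : P 5 := (∏ i : Fin 5, X i) * f ^ 2


abbrev hc (n d : ℕ) : P n →ₗ[ZMod 2] P n := homogeneousComponent d

def HitL (n d : ℕ) : P n →ₗ[ZMod 2] P n :=
  (hc n d).comp ((SqT n).toLinearMap - LinearMap.id)

lemma HitL_apply (n d : ℕ) (p : P n) :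
    HitL n d p = homogeneousComponent d (SqT n p) - homogeneousComponent d p := by
  simp [HitL]

lemma Sq_mono {n : ℕ} (a : Fin n →₀ ℕ) :
    ∃ g : P n, SqT n (mono a) = mono a * g ∧ coeff 0 g = 1 := by
  refine ⟨∏ i, (1 + X i) ^ a i, ?_, ?_⟩
  · rw [mono, monomial_eq, Finsupp.prod_fintype _ _ (by simp)]
    simp only [map_prod, map_pow, one_mul, map_one]
    rw [← Finset.prod_mul_distrib]
    refine Finset.prod_congr rfl fun i _ => ?_
    rw [← mul_pow]
    congr 1
    simp [SqT]; ring
  · have : ∀ p : P n, coeff 0 p = constantCoeff p := fun p => rfl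
    rw [this]
    simp

lemma hc_Sq_mono {n : ℕ} (a : Fin n →₀ ℕ) (d : ℕ) (h : d ≤ a.degree) :
    homogeneousComponent d (SqT n (mono a)) = homogeneousComponent d (mono a) := by
  obtain ⟨g, hg, h0⟩ := Sq_mono a
  rw [hg]
  ext b
  simp only [coeff_homogeneousComponent]
  split_ifs with hb
  · rw [mono, coeff_monomial_mul', coeff_monomial]
    split_ifs with h1 h2 h2
    · subst h2; simpa using h0
    · exfalso
      apply h2
      obtain ⟨c, rfl⟩ := le_iff_exists_add.1 h1
      rw [map_add] at hb
      have : c.degree = 0 := by omega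
      rw [Finsupp.degree_eq_zero_iff] at this
      simp [this]
    · exact absurd h2.le h1
    · rfl
  · rfl

lemma poly_eq_sum {n : ℕ} (f : P n) : f = ∑ a ∈ f.support, mono a := by
  conv_lhs => rw [f.as_sum]
  refine Finset.sum_congr rfl fun a ha => ?_
  have h2 : ∀ c : ZMod 2, c ≠ 0 → c = 1 := by decide
  rw [mono, h2 _ (mem_support_iff.1 ha)]

lemma hc_Sq_hom {n : ℕ} (f : P n) (d e : ℕ) (hf : f.IsHomogeneous e) (h : d ≤ e) :
    homogeneousComponent d (SqT n f) = homogeneousComponent d f := by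
  rw [poly_eq_sum f]
  simp only [map_sum]
  refine Finset.sum_congr rfl fun a ha => hc_Sq_mono a d ?_
  have := hf (mem_support_iff.1 ha)
  rw [Finsupp.degree_eq_weight_one]
  exact h.trans this.ge

lemma hc_hc {n : ℕ} (d e : ℕ) (f : P n) : homogeneousComponent d (homogeneousComponent e f)
    = if e = d then homogeneousComponent d f else 0 := by
  rw [homogeneousComponent_of_mem (homogeneousComponent_mem e f)]
  split_ifs with h1 h2 h2
  · subst h1; rfl
  · exact absurd h1.symm h2
  · exact absurd h2.symm h1
  · rfl

lemma HitL_hom {n : ℕ} (f : P n) (d e : ℕ) (hf : f.IsHomogeneous e) (h : d ≤ e) :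
    HitL n d f = 0 := by
  rw [HitL_apply, hc_Sq_hom f d e hf h, sub_self]

lemma isHit_iff (n d : ℕ) (u : P n) : IsHit n d u ↔ u ∈ LinearMap.range (HitL n d) := by
  constructor
  · rintro ⟨f, hf, rfl⟩
    refine ⟨∑ i ∈ Finset.Icc 1 d, f i, ?_⟩
    rw [map_sum]
    refine Finset.sum_congr rfl fun i hi => ?_
    rw [Finset.mem_Icc] at hi
    rw [HitL_apply, homogeneousComponent_of_mem (hf i), if_neg (by omega), sub_zero]
  · rintro ⟨p, rfl⟩
    refine ⟨fun i => homogeneousComponent (d - i) p, fun i => homogeneousComponent_mem _ _, ?_⟩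
    have key : ∀ N, HitL n d (∑ e ∈ Finset.range (d + N), homogeneousComponent e p) =
        HitL n d (∑ e ∈ Finset.range d, homogeneousComponent e p) := by
      intro N
      induction N with
      | zero => rfl
      | succ N ih =>
        rw [← add_assoc, Finset.sum_range_succ, map_add, ih,
          HitL_hom _ d (d + N) (homogeneousComponent_isHomogeneous _ _) (by omega), add_zero]
    have h1 : HitL n d p = HitL n d (∑ e ∈ Finset.range d, homogeneousComponent e p) := by
      rw [← key (p.totalDegree + 1)]
      conv_lhs => rw [← sum_homogeneousComponent p]
      congr 1
      refine Finset.sum_subset (by intro x; simp; omega) fun e _ he => ?_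
      apply homogeneousComponent_eq_zero
      simpa using he
    rw [h1, map_sum]
    refine Finset.sum_nbij' (fun e => d - e) (fun i => d - i) ?_ ?_ ?_ ?_ ?_
    · intro e; simp; omega
    · intro e; simp; omega
    · intro e; simp; omega
    · intro e; simp; omega
    · intro e he
      simp at he
      rw [HitL_apply, hc_hc, if_neg (by omega), sub_zero]
      simp only [Nat.sub_sub_self he.le]

lemma hitSub_eq (n d : ℕ) : hitSub n d = LinearMap.range (HitL n d) := by
  rw [hitSub]
  have : {u | IsHit n d u} = (LinearMap.range (HitL n d) : Set (P n)) := by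
    ext u; exact isHit_iff n d u
  rw [this, Submodule.span_eq]


def ones : Fin 5 →₀ ℕ := Finsupp.equivFunOnFinite.symm fun _ => 1

lemma ones_apply (i : Fin 5) : ones i = 1 := rfl

lemma S5_mono (a : Fin 5 →₀ ℕ) : S5 (mono a) =
    if ∀ i, Odd (a i) then mono (Finsupp.equivFunOnFinite.symm fun i => a i / 2) else 0 := by
  have : mono a = basisMonomials (Fin 5) (ZMod 2) a := by simp [mono]
  rw [this, S5, Module.Basis.constr_basis]

lemma coeff_S5 (f : P 5) (b : Fin 5 →₀ ℕ) : coeff b (S5 f) = coeff (2 • b + ones) f := by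
  rw [poly_eq_sum f]
  simp only [map_sum, coeff_sum]
  refine Finset.sum_congr rfl fun a _ => ?_
  rw [S5_mono]
  split_ifs with h
  · simp only [mono, coeff_monomial]
    congr 1
    rw [eq_iff_iff]
    constructor
    · rintro rfl
      ext i
      have := h i
      simp only [Finsupp.add_apply, Finsupp.smul_apply, ones_apply, smul_eq_mul,
        Finsupp.equivFunOnFinite_symm_apply_apply]
      rw [Nat.odd_iff] at this
      omega
    · rintro rfl
      ext i
      simp only [Finsupp.add_apply, Finsupp.smul_apply, ones_apply, smul_eq_mul,
        Finsupp.equivFunOnFinite_symm_apply_apply]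
      omega
  · rw [mono, coeff_monomial, if_neg, coeff_zero]
    rintro rfl
    apply h
    intro i
    simp only [Finsupp.add_apply, Finsupp.smul_apply, ones_apply, smul_eq_mul]
    exact ⟨_, rfl⟩

lemma degree_dbl (b : Fin 5 →₀ ℕ) : (2 • b + ones).degree = 2 * b.degree + 5 := by
  rw [map_add, map_nsmul, Finsupp.degree_eq_sum ones]
  simp [ones_apply]

lemma S5_hc (m : ℕ) (f : P 5) :
    S5 (homogeneousComponent (2 * m + 5) f) = homogeneousComponent m (S5 f) := by
  ext b
  rw [coeff_S5, coeff_homogeneousComponent, coeff_homogeneousComponent, coeff_S5, degree_dbl]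
  congr 1
  rw [eq_iff_iff]; omega

lemma sum_sq {n : ℕ} {ι : Type*} (s : Finset ι) (f : ι → P n) :
    (∑ i ∈ s, f i) ^ 2 = ∑ i ∈ s, f i ^ 2 := sum_pow_char 2 s f

lemma mono_sq {n : ℕ} (a : Fin n →₀ ℕ) : (mono a) ^ 2 = mono (2 • a) := by
  simp [mono, monomial_pow]

lemma S5_mul_sq (g h : P 5) : S5 (g * h ^ 2) = S5 g * h := by
  rw [poly_eq_sum h, sum_sq]
  simp only [Finset.mul_sum, map_sum]
  refine Finset.sum_congr rfl fun a _ => ?_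
  rw [mono_sq]
  ext c
  rw [coeff_S5, mono, mono, coeff_mul_monomial', coeff_mul_monomial', coeff_S5]
  have hiff : 2 • a ≤ 2 • c + ones ↔ a ≤ c := by
    rw [Finsupp.le_def, Finsupp.le_def]
    refine forall_congr' fun i => ?_
    simp only [Finsupp.add_apply, Finsupp.smul_apply, ones_apply, smul_eq_mul]
    omega
  simp only [hiff]
  split_ifs with hle
  · congr 2
    ext i
    have := hle i
    simp only [Finsupp.add_apply, Finsupp.smul_apply, ones_apply, smul_eq_mul, Finsupp.tsub_apply]
    omega
  · rfl

lemma prodX {n : ℕ} (I : Finset (Fin n)) :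
    (∏ i ∈ I, X i : P n) = mono (∑ i ∈ I, Finsupp.single i 1) := by
  rw [mono, monomial_sum_one]; rfl

lemma indic_apply {n : ℕ} (I : Finset (Fin n)) (j : Fin n) :
    (∑ i ∈ I, Finsupp.single i 1 : Fin n →₀ ℕ) j = if j ∈ I then 1 else 0 := by
  rw [Finsupp.finsetSum_apply]
  simp [Finsupp.single_apply]

lemma S5_prodX (I : Finset (Fin 5)) :
    S5 (∏ i ∈ I, X i) = if I = Finset.univ then 1 else 0 := by
  rw [prodX, S5_mono]
  simp only [indic_apply]
  split_ifs with h1 h2 h2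
  · subst h2
    simp only [Finset.mem_univ, if_true]
    rw [mono, show (Finsupp.equivFunOnFinite.symm fun i : Fin 5 => 1 / 2) = 0 by ext i; simp]
    rfl
  · exfalso
    apply h2
    ext i
    have := h1 i
    by_contra hh
    simp at hh
    simp [hh] at this
  · exfalso
    subst h2
    apply h1
    intro i
    simp
  · rfl

lemma mono_decomp {n : ℕ} (a : Fin n →₀ ℕ) :
    mono a = (∏ i ∈ Finset.univ.filter (fun i => Odd (a i)), X i) *
      (mono (Finsupp.equivFunOnFinite.symm fun i => a i / 2)) ^ 2 := by
  rw [prodX, mono_sq, mono, mono, mono, monomial_mul, one_mul]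
  refine congrArg (fun c => monomial c (1 : ZMod 2)) ?_
  ext i
  rw [Finsupp.add_apply, indic_apply]
  simp only [Finset.mem_filter, Finset.mem_univ, true_and, Finsupp.smul_apply, smul_eq_mul,
        Finsupp.equivFunOnFinite_symm_apply_apply, Nat.odd_iff]
  split_ifs <;> omega

lemma S5_Sq (f : P 5) : S5 (SqT 5 f) = SqT 5 (S5 f) := by
  rw [poly_eq_sum f]
  simp only [map_sum]
  refine Finset.sum_congr rfl fun a _ => ?_
  rw [mono_decomp a]
  set I := Finset.univ.filter (fun i => Odd (a i))
  rw [map_mul, map_pow, S5_mul_sq, S5_mul_sq, map_mul, S5_prodX, map_prod]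
  congr 1
  have : ∀ i, SqT 5 (X i) = X i + X i ^ 2 := fun i => by simp [SqT]
  simp only [this]
  rw [Finset.prod_add, map_sum]
  simp only [Finset.prod_pow, S5_mul_sq, S5_prodX]
  split_ifs with h
  · rw [h, Finset.sum_eq_single Finset.univ]
    · simp
    · intro b _ hb; simp [hb]
    · simp
  · rw [map_zero]
    refine Finset.sum_eq_zero fun t ht => ?_
    rw [if_neg, zero_mul]
    rintro rfl
    exact h (Finset.univ_subset_iff.1 (Finset.mem_powerset.1 ht))

lemma S5_Phi (f : P 5) : S5 (Phi f) = f := by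
  rw [Phi, S5_mul_sq, S5_prodX, if_pos rfl, one_mul]

lemma S5_HitL (m : ℕ) (p : P 5) : S5 (HitL 5 (2 * m + 5) p) = HitL 5 m (S5 p) := by
  rw [HitL_apply, HitL_apply, map_sub, S5_hc, S5_hc, S5_Sq]


lemma hc_lowdeg {n : ℕ} (c : Fin n →₀ ℕ) (g : P n) (k : ℕ)
    (hg : ∀ b, k ≤ b.degree → coeff b g = 0) :
    ∀ b, k + c.degree ≤ b.degree → coeff b (mono c * g) = 0 := by
  intro b hb
  rw [mono, coeff_monomial_mul']
  split_ifs with h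
  · obtain ⟨e, rfl⟩ := le_iff_exists_add.1 h
    rw [map_add] at hb
    rw [add_tsub_cancel_left, hg _ (by omega), mul_zero]
  · rfl

lemma Sq_top {n : ℕ} (a : Fin n →₀ ℕ) : ∃ g : P n, SqT n (mono a) = mono a ^ 2 + g ∧
    ∀ b, 2 * a.degree ≤ b.degree → coeff b g = 0 := by
  induction a using Finsupp.induction_linear with
  | zero => exact ⟨0, by simp [mono], by simp⟩
  | single i k =>
    induction k with
    | zero => exact ⟨0, by simp [mono], by simp⟩
    | succ k ih =>
      obtain ⟨g, hg, hg2⟩ := ih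
      have hX : (mono (Finsupp.single i (k+1)) : P n) = mono (Finsupp.single i k) * mono (Finsupp.single i 1) := by
        simp [mono, monomial_mul]
      have hS : SqT n (mono (Finsupp.single i 1)) = mono (Finsupp.single i 1) + mono (Finsupp.single i 1) ^ 2 := by
        change SqT n (X i) = X i + X i ^ 2
        simp [SqT]
      refine ⟨mono (Finsupp.single i 1) * (mono (Finsupp.single i k) ^ 2)
        + mono (Finsupp.single i 1) * g + mono (2 • Finsupp.single i 1) * g, ?_, ?_⟩
      · rw [hX, map_mul, hg, hS, ← mono_sq]; ring
      · intro b hb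
        rw [Finsupp.degree_single] at hb hg2
        rw [coeff_add, coeff_add]
        rw [hc_lowdeg _ g _ hg2 b (by rw [Finsupp.degree_single]; omega),
          hc_lowdeg _ g _ hg2 b (by rw [map_nsmul, Finsupp.degree_single, smul_eq_mul]; omega),
          hc_lowdeg _ _ (2 * k + 1) ?_ b (by rw [Finsupp.degree_single]; omega)]
        · simp
        · intro b hb
          rw [mono_sq, mono, coeff_monomial, if_neg]
          rintro rfl
          rw [map_nsmul, Finsupp.degree_single, smul_eq_mul] at hb; omega
  | add a c ha hc =>
    obtain ⟨g, hg, hg2⟩ := ha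
    obtain ⟨g', hg', hg2'⟩ := hc
    have hX : (mono (a + c) : P n) = mono a * mono c := by
        simp [mono, monomial_mul]
    refine ⟨mono (2 • a) * g' + mono (2 • c) * g + g * g', ?_, ?_⟩
    · rw [hX, map_mul, hg, hg', ← mono_sq, ← mono_sq]; ring
    · intro b hb
      rw [map_add] at hb
      rw [coeff_add, coeff_add]
      rw [hc_lowdeg _ g' _ hg2' b (by rw [map_nsmul, smul_eq_mul]; omega),
          hc_lowdeg _ g _ hg2 b (by rw [map_nsmul, smul_eq_mul]; omega), coeff_mul]
      rw [Finset.sum_eq_zero, add_zero, add_zero]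
      rintro ⟨u, v⟩ huv
      rw [Finset.HasAntidiagonal.mem_antidiagonal] at huv
      simp only at huv ⊢
      subst huv
      rw [map_add] at hb
      by_cases hu : 2 * a.degree ≤ u.degree
      · rw [hg2 u hu, zero_mul]
      · rw [hg2' v (by omega), mul_zero]

lemma hc_ideal {n : ℕ} (M d : ℕ) (hd : d < M) (p : P n)
    (hp : p ∈ Ideal.span (Set.range fun i : Fin n => (X i ^ M : P n))) :
    homogeneousComponent d p = 0 := by
  have key : ∀ b : Fin n →₀ ℕ, b.degree < M → coeff b p = 0 := by
    induction hp using Submodule.span_induction with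
    | zero => simp
    | add x y _ _ hx hy => intro b hb; rw [coeff_add, hx b hb, hy b hb, add_zero]
    | smul a x _ hx =>
      intro b hb
      rw [smul_eq_mul, coeff_mul]
      refine Finset.sum_eq_zero ?_
      rintro ⟨u, v⟩ huv
      rw [Finset.HasAntidiagonal.mem_antidiagonal] at huv
      simp only at huv ⊢
      subst huv
      rw [map_add] at hb
      rw [hx v (by omega), mul_zero]
    | mem x hx =>
      obtain ⟨i, rfl⟩ := hx
      intro b hb
      simp only [coeff_X_pow]
      rw [if_neg]
      rintro rfl
      rw [Finsupp.degree_single] at hb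
      omega
  ext b
  rw [coeff_homogeneousComponent, coeff_zero]
  split_ifs with hb
  · exact key b (by omega)
  · rfl

lemma telescope {n : ℕ} (x : P n) (N : ℕ) :
    ∑ k ∈ Finset.range (N + 1), (x ^ 2 ^ k + x ^ 2 ^ (k+1)) = x + x ^ 2 ^ (N + 1) := by
  induction N with
  | zero => simp
  | succ N ih =>
    rw [Finset.sum_range_succ, ih]
    have : x ^ 2 ^ (N + 1) + x ^ 2 ^ (N + 1) = 0 := CharTwo.add_self_eq_zero _
    linear_combination this

/-- Wood-type lemma. -/
lemma wood {n : ℕ} (I : Finset (Fin n)) (c : Fin n →₀ ℕ) (d : ℕ) (hd : d = I.card + 2 * c.degree)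
    (hno : ∀ k : Fin n → ℕ, ∑ i ∈ I, 2 ^ k i ≠ I.card + c.degree) :
    (∏ i ∈ I, X i) * mono c ^ 2 ∈ LinearMap.range (HitL n d) := by
  set C : P n := ∏ i ∈ I, ∑ k ∈ Finset.range (d + 1), X i ^ 2 ^ k with hC
  refine ⟨C * mono c, ?_⟩
  have h1 : homogeneousComponent d (C * mono c) = 0 := by
    rw [hC, Finset.prod_sum, Finset.sum_mul, map_sum]
    refine Finset.sum_eq_zero fun k _ => ?_
    have hh : ((∏ i ∈ I.attach, (X i.1 ^ 2 ^ k i.1 i.2 : P n)) * mono c).IsHomogeneous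
        (∑ i ∈ I.attach, 2 ^ k i.1 i.2 + c.degree) := by
      refine IsHomogeneous.mul (IsHomogeneous.prod _ _ _ fun i _ => isHomogeneous_X_pow _ _) ?_
      exact isHomogeneous_monomial _ rfl
    rw [homogeneousComponent_of_mem hh, if_neg]
    have := hno (fun i => if h : i ∈ I then k i h else 0)
    rw [← Finset.sum_attach] at this
    simp only [Finset.coe_mem, dif_pos] at this
    omega
  have h2 : SqT n C = ∏ i ∈ I, (X i + X i ^ 2 ^ (d + 1)) := by
    rw [hC, map_prod]
    refine Finset.prod_congr rfl fun i _ => ?_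
    rw [map_sum, ← telescope]
    refine Finset.sum_congr rfl fun k _ => ?_
    rw [map_pow, show SqT n (X i) = X i + X i ^ 2 by simp [SqT], add_pow_char_pow, ← pow_mul, pow_succ' 2 k]
  have h3 : SqT n C - ∏ i ∈ I, X i ∈
      Ideal.span (Set.range fun i : Fin n => (X i ^ 2 ^ (d + 1) : P n)) := by
    rw [← Ideal.Quotient.eq, h2, map_prod, map_prod]
    refine Finset.prod_congr rfl fun i _ => ?_
    rw [Ideal.Quotient.eq, add_sub_cancel_left]
    exact Ideal.subset_span ⟨i, rfl⟩
  have h4 : d < 2 ^ (d + 1) := lt_trans (Nat.lt_succ_self d) Nat.lt_two_pow_self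
  obtain ⟨g, hg, hg2⟩ := Sq_top c
  rw [HitL_apply, h1, sub_zero, map_mul]
  have h5 : SqT n C * SqT n (mono c) = (SqT n C - ∏ i ∈ I, X i) * SqT n (mono c)
      + (∏ i ∈ I, X i) * mono c ^ 2 + (∏ i ∈ I, X i) * g := by
    rw [hg]; ring
  rw [h5, map_add, map_add, hc_ideal _ d h4 _ (Ideal.mul_mem_right _ _ h3), zero_add]
  have h6 : ((∏ i ∈ I, (X i : P n)) * mono c ^ 2).IsHomogeneous d := by
    have := (IsHomogeneous.prod I (fun i => (X i : P n)) (fun _ => 1) fun i _ => isHomogeneous_X _ _).mul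
      ((isHomogeneous_monomial (R := ZMod 2) (d := c) 1 rfl).pow 2)
    have he : d = ∑ _i ∈ I, 1 + c.degree * 2 := by simp [hd]; ring
    rw [he]
    exact this
  rw [homogeneousComponent_eq_self h6]
  have h7 : homogeneousComponent d ((∏ i ∈ I, X i) * g) = 0 := by
    ext b
    rw [coeff_homogeneousComponent, coeff_zero]
    split_ifs with hb
    · rw [prodX]
      refine hc_lowdeg _ g _ hg2 b ?_
      rw [map_sum]
      simp
      omega
    · rfl
  rw [h7, add_zero]

lemma pow_cases (k : ℕ) : 2 ^ k = 1 ∨ 2 ^ k = 2 ∨ 2 ^ k = 4 ∨ ∃ t, 2 ^ k = 8 * t := by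
  match k with
  | 0 => simp
  | 1 => simp
  | 2 => simp
  | k + 3 => exact Or.inr (Or.inr (Or.inr ⟨2 ^ k, by ring⟩))

lemma pow_cases' (k : ℕ) : 2 ^ k = 1 ∨ 2 ^ k = 2 ∨ 2 ^ k = 4 ∨ 2 ^ k % 8 = 0 := by
  rcases pow_cases k with h | h | h | ⟨t, h⟩ <;> omega

lemma arith (I : Finset (Fin 5)) (hI : I ≠ Finset.univ) (d m t : ℕ) (ht : 2 ≤ t)
    (hd : d + 5 = 16 * t) (hm : d = I.card + 2 * m) (k : Fin 5 → ℕ) :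
    ∑ i ∈ I, 2 ^ k i ≠ I.card + m := by
  intro h
  have hc : I.card < 5 := by
    have := Finset.card_lt_card (Finset.ssubset_univ_iff.2 hI)
    simpa using this
  have : I.card = 1 ∨ I.card = 3 := by omega
  rcases this with h1 | h1
  · obtain ⟨x, rfl⟩ := Finset.card_eq_one.1 h1
    rw [h1, Finset.sum_singleton] at h
    have := pow_cases' (k x)
    omega
  · obtain ⟨x, y, z, hxy, hxz, hyz, rfl⟩ := Finset.card_eq_three.1 h1
    rw [h1, Finset.sum_insert (by simp [hxy, hxz]), Finset.sum_pair hyz] at h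
    have := pow_cases' (k x)
    have := pow_cases' (k y)
    have := pow_cases' (k z)
    omega

lemma hit_of_S5_zero (d t : ℕ) (ht : 2 ≤ t) (hd : d + 5 = 16 * t) (f : P 5)
    (hf : f.IsHomogeneous d) (h0 : S5 f = 0) : f ∈ LinearMap.range (HitL 5 d) := by
  rw [poly_eq_sum f]
  refine Submodule.sum_mem _ fun a ha => ?_
  have hdeg := hf (mem_support_iff.1 ha)
  have hdeg' : a.degree = d := by rw [Finsupp.degree_eq_weight_one]; exact hdeg
  have hI : Finset.univ.filter (fun i => Odd (a i)) ≠ Finset.univ := by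
    intro hI
    have hodd : ∀ i, Odd (a i) := fun i => by
      have := Finset.mem_univ i
      rw [← hI] at this
      simpa using this
    have := coeff_S5 f (Finsupp.equivFunOnFinite.symm fun i => a i / 2)
    rw [h0, coeff_zero] at this
    apply mem_support_iff.1 ha
    rw [this]
    congr 1
    ext i
    have := hodd i
    simp only [Finsupp.add_apply, Finsupp.smul_apply, ones_apply, smul_eq_mul,
        Finsupp.equivFunOnFinite_symm_apply_apply]
    rw [Nat.odd_iff] at this
    omega
  rw [mono_decomp a]
  have hcard : d = (Finset.univ.filter (fun i => Odd (a i))).card +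
      2 * (Finsupp.equivFunOnFinite.symm fun i => a i / 2 : Fin 5 →₀ ℕ).degree := by
    rw [Finset.card_filter, Finsupp.degree_eq_sum, Finset.mul_sum, ← Finset.sum_add_distrib,
      ← hdeg', Finsupp.degree_eq_sum]
    refine Finset.sum_congr rfl fun i _ => ?_
    simp only [Finsupp.equivFunOnFinite_symm_apply_apply, Nat.odd_iff]
    split_ifs <;> omega
  exact wood _ _ d hcard (arith _ hI d _ t ht hd hcard)

lemma kameko (m t : ℕ) (ht : 2 ≤ t) (hd : 2 * m + 5 + 5 = 16 * t) (g : P 5)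
    (hg : g.IsHomogeneous (2 * m + 5)) :
    g ∈ LinearMap.range (HitL 5 (2 * m + 5)) ↔ S5 g ∈ LinearMap.range (HitL 5 m) := by
  constructor
  · rintro ⟨p, rfl⟩
    exact ⟨S5 p, (S5_HitL m p).symm⟩
  · rintro ⟨p, hp⟩
    have h1 : S5 (g - HitL 5 (2 * m + 5) (Phi p)) = 0 := by
      rw [map_sub, S5_HitL, S5_Phi, hp, sub_self]
    have h2 : (HitL 5 (2 * m + 5) (Phi p)).IsHomogeneous (2 * m + 5) :=
      homogeneousComponent_isHomogeneous _ _
    have := hit_of_S5_zero _ t ht hd _ (hg.sub h2) h1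
    simpa using Submodule.add_mem _ this ⟨Phi p, rfl⟩


abbrev KeyT (n : ℕ) : Type := Lex (ℕ → ℕ) ×ₗ Lex (Fin n → ℕ)

def keyM {n : ℕ} (a : Fin n →₀ ℕ) : KeyT n :=
  toLex (toLex (wVec a), toLex (⇑a))

lemma keyM_inj {n : ℕ} {a b : Fin n →₀ ℕ} (h : keyM a = keyM b) : a = b := by
  have h1 := congrArg (fun x => ofLex (ofLex x).2) h
  exact DFunLike.coe_injective h1

lemma monLt_iff {n : ℕ} (a b : Fin n →₀ ℕ) : monLt a b ↔ keyM a < keyM b := by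
  rw [Prod.Lex.lt_iff]
  exact Iff.rfl

lemma degA_eq {n : ℕ} (a : Fin n →₀ ℕ) : degA a = a.degree := by
  rw [degA, Finsupp.degree_eq_sum]

lemma finite_deg (n d : ℕ) : {a : Fin n →₀ ℕ | degA a = d}.Finite := by
  have : {a : Fin n →₀ ℕ | degA a = d} ⊆ Set.Iic (Finsupp.equivFunOnFinite.symm fun _ => d) := by
    intro a ha i
    have ha' : ∑ i, a i = d := ha
    have := Finset.single_le_sum (f := fun i => a i) (fun _ _ => Nat.zero_le _) (Finset.mem_univ i)
    simp only [ha'] at this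
    simpa using this
  exact (Set.finite_Iic _).subset this

def admSpan (n d : ℕ) : Submodule (ZMod 2) (P n) :=
  Submodule.span (ZMod 2) {f | ∃ a : Fin n →₀ ℕ, degA a = d ∧ Admissible a ∧ f = mono a}

lemma mono_mem_W {n d : ℕ} (a : Fin n →₀ ℕ) (ha : degA a = d) :
    mono a ∈ admSpan n d ⊔ LinearMap.range (HitL n d) := by
  by_contra hbad
  let B : Set (Fin n →₀ ℕ) :=
    {a | degA a = d ∧ mono a ∉ admSpan n d ⊔ LinearMap.range (HitL n d)}
  have hfin : B.Finite := (finite_deg n d).subset fun a h => h.1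
  obtain ⟨m, hm, hmin⟩ := Set.exists_min_image B keyM hfin ⟨a, ha, hbad⟩
  apply hm.2
  by_cases hadm : Admissible m
  · exact Submodule.mem_sup_left (Submodule.subset_span ⟨m, hm.1, hadm, rfl⟩)
  · obtain ⟨S, hS, hhit⟩ := not_not.1 hadm
    rw [hm.1, isHit_iff] at hhit
    have h2 : ∑ b ∈ S, mono b ∈ admSpan n d ⊔ LinearMap.range (HitL n d) := by
      refine Submodule.sum_mem _ fun b hb => ?_
      by_contra hb2
      have := hmin b ⟨(hS b hb).1.trans hm.1, hb2⟩
      exact absurd ((monLt_iff _ _).1 (hS b hb).2) (not_lt.2 this)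
    have := Submodule.add_mem _ (Submodule.mem_sup_right hhit) h2
    simpa using this

lemma hom_mem_W {n d : ℕ} (f : P n) (hf : f.IsHomogeneous d) :
    f ∈ admSpan n d ⊔ LinearMap.range (HitL n d) := by
  rw [poly_eq_sum f]
  refine Submodule.sum_mem _ fun a ha => mono_mem_W a ?_
  rw [degA_eq, Finsupp.degree_eq_weight_one]
  exact hf (mem_support_iff.1 ha)

lemma adm_indep {n d : ℕ} (T : Finset (Fin n →₀ ℕ))
    (hT : ∀ a ∈ T, degA a = d ∧ Admissible a)
    (h : ∑ a ∈ T, mono a ∈ LinearMap.range (HitL n d)) : T = ∅ := by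
  by_contra hne
  obtain ⟨m, hm, hmax⟩ := Finset.exists_max_image T keyM (Finset.nonempty_iff_ne_empty.2 hne)
  refine (hT m hm).2 ⟨T.erase m, ?_, ?_⟩
  · intro b hb
    rw [Finset.mem_erase] at hb
    refine ⟨(hT b hb.2).1.trans (hT m hm).1.symm, (monLt_iff _ _).2 ?_⟩
    exact lt_of_le_of_ne (hmax b hb.2) fun h => hb.1 (keyM_inj h)
  · rw [(hT m hm).1, isHit_iff, CharTwo.sub_eq_add, Finset.add_sum_erase _ _ hm]
    exact h

def ee : ℕ → ℕ
  | 0 => 67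
  | k + 1 => 2 * ee k + 5

lemma ee_eq (k : ℕ) : ee k + 5 = 72 * 2 ^ k := by
  induction k with
  | zero => rfl
  | succ k ih => rw [ee, pow_succ]; omega

lemma S5_hom (m : ℕ) (g : P 5) (hg : g.IsHomogeneous (2 * m + 5)) : (S5 g).IsHomogeneous m := by
  rw [← homogeneousComponent_eq_self hg, S5_hc]
  exact homogeneousComponent_isHomogeneous _ _

lemma kam_iter (k : ℕ) : ∀ g : P 5, g.IsHomogeneous (ee k) →
    ((S5 ^ k) g).IsHomogeneous 67 ∧
    (g ∈ LinearMap.range (HitL 5 (ee k)) ↔ (S5 ^ k) g ∈ LinearMap.range (HitL 5 67)) := by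
  induction k with
  | zero => intro g hg; exact ⟨hg, Iff.rfl⟩
  | succ k ih =>
    intro g hg
    obtain ⟨h1, h2⟩ := ih (S5 g) (S5_hom _ g hg)
    rw [pow_succ]
    refine ⟨h1, ?_⟩
    refine Iff.trans ?_ h2
    have h3 := ee_eq k
    have h4 : 0 < 2 ^ k := by positivity
    exact kameko (ee k) (9 * 2 ^ k) (by omega) (by omega) g hg

lemma Phi_iter (k : ℕ) (f : P 5) : (S5 ^ k) (Phi^[k] f) = f := by
  induction k with
  | zero => rfl
  | succ k ih =>
    rw [pow_succ, Function.iterate_succ_apply']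
    change (S5 ^ k) (S5 (Phi (Phi^[k] f))) = f
    rw [S5_Phi, ih]

lemma Phi_hom (k : ℕ) (f : P 5) (hf : f.IsHomogeneous 67) :
    (Phi^[k] f).IsHomogeneous (ee k) := by
  induction k with
  | zero => exact hf
  | succ k ih =>
    rw [Function.iterate_succ_apply']
    have := (IsHomogeneous.prod (Finset.univ : Finset (Fin 5)) (fun i => (X i : P 5))
      (fun _ => 1) fun i _ => isHomogeneous_X _ _).mul (ih.pow 2)
    have he : ee (k + 1) = ∑ _i : Fin 5, 1 + ee k * 2 := by simp [ee]; ring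
    rw [he]
    exact this

def clsL (n d : ℕ) : P n →ₗ[ZMod 2] QP n d :=
  ((hitSub n d).comap (homSub n d).subtype).mkQ.comp
    ((hc n d).codRestrict (homSub n d) fun f => homogeneousComponent_mem d f)

lemma cls_eq (n d : ℕ) (f : P n) : cls n d f = clsL n d f := rfl

lemma clsL_zero (n d : ℕ) (f : P n) :
    clsL n d f = 0 ↔ homogeneousComponent d f ∈ LinearMap.range (HitL n d) := by
  rw [← hitSub_eq, clsL, LinearMap.comp_apply, Submodule.mkQ_apply, Submodule.Quotient.mk_eq_zero]
  exact Iff.rfl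

lemma clsL_surj (n d : ℕ) (x : QP n d) : ∃ f : P n, f.IsHomogeneous d ∧ clsL n d f = x := by
  obtain ⟨⟨f, hf⟩, rfl⟩ := Submodule.Quotient.mk_surjective _ x
  refine ⟨f, hf, ?_⟩
  rw [← cls_eq, cls]
  congr 1
  exact Subtype.ext (homogeneousComponent_eq_self hf)

lemma mono_hom {d : ℕ} (a : Fin 5 →₀ ℕ) (ha : degA a = d) : (mono a : P 5).IsHomogeneous d :=
  isHomogeneous_monomial _ (by rw [← degA_eq, ha])

lemma main (k d : ℕ) (hd : d = ee k) :
    Submodule.span (ZMod 2)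
      {x : QP 5 d | ∃ a : Fin 5 →₀ ℕ,
        degA a = 67 ∧ Admissible a ∧ x = cls 5 d (Phi^[k] (mono a))} = ⊤ ∧
    LinearIndependent (ZMod 2)
      (fun x : {x : QP 5 d | ∃ a : Fin 5 →₀ ℕ,
        degA a = 67 ∧ Admissible a ∧ x = cls 5 d (Phi^[k] (mono a))} => (x : QP 5 d)) := by
  subst hd
  constructor
  · rw [eq_top_iff]
    rintro x -
    obtain ⟨g, hg, rfl⟩ := clsL_surj _ _ x
    obtain ⟨h1, h2⟩ := kam_iter k g hg
    obtain ⟨u, hu, w, hw, huw⟩ := Submodule.mem_sup.1 (hom_mem_W _ h1)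
    have key : ∀ u ∈ admSpan 5 67, ∃ v : P 5, v.IsHomogeneous (ee k) ∧ (S5 ^ k) v = u ∧
        clsL 5 (ee k) v ∈ Submodule.span (ZMod 2)
          {x : QP 5 (ee k) | ∃ a : Fin 5 →₀ ℕ,
            degA a = 67 ∧ Admissible a ∧ x = cls 5 (ee k) (Phi^[k] (mono a))} := by
      intro u hu
      induction hu using Submodule.span_induction with
      | zero => exact ⟨0, isHomogeneous_zero _ _ _, map_zero _, by rw [map_zero]; exact zero_mem _⟩
      | add x y _ _ hx hy =>
        obtain ⟨v, hv1, hv2, hv3⟩ := hx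
        obtain ⟨v', hv1', hv2', hv3'⟩ := hy
        exact ⟨v + v', hv1.add hv1', by rw [map_add, hv2, hv2'], by
          rw [map_add]; exact Submodule.add_mem _ hv3 hv3'⟩
      | smul c x _ hx =>
        obtain ⟨v, hv1, hv2, hv3⟩ := hx
        exact ⟨c • v, (homSub 5 (ee k)).smul_mem c hv1, by rw [map_smul, hv2], by
          rw [map_smul]; exact Submodule.smul_mem _ _ hv3⟩
      | mem x hx =>
        obtain ⟨a, ha, hadm, rfl⟩ := hx
        exact ⟨Phi^[k] (mono a), Phi_hom k _ (mono_hom a ha), Phi_iter _ _,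
          Submodule.subset_span ⟨a, ha, hadm, rfl⟩⟩
    obtain ⟨v, hv1, hv2, hv3⟩ := key u hu
    have h3 : clsL 5 (ee k) (g - v) = 0 := by
      rw [clsL_zero, homogeneousComponent_eq_self (hg.sub hv1), (kam_iter k _ (hg.sub hv1)).2,
        map_sub, hv2, ← huw, add_sub_cancel_left]
      exact hw
    rw [map_sub, sub_eq_zero] at h3
    rw [h3]
    exact hv3
  · let w : {a : Fin 5 →₀ ℕ // degA a = 67 ∧ Admissible a} → QP 5 (ee k) :=
      fun a => clsL 5 (ee k) (Phi^[k] (mono a.1))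
    have hw : LinearIndependent (ZMod 2) w := by
      rw [linearIndependent_iff']
      intro s c hsum i hi
      by_contra hci
      have hh : (∑ i ∈ s, c i • Phi^[k] (mono i.1)).IsHomogeneous (ee k) :=
        (homSub 5 (ee k)).sum_mem fun i _ =>
          (homSub 5 (ee k)).smul_mem _ (Phi_hom k _ (mono_hom i.1 i.2.1))
      have h1 : clsL 5 (ee k) (∑ i ∈ s, c i • Phi^[k] (mono i.1)) = 0 := by
        rw [map_sum, ← hsum]
        exact Finset.sum_congr rfl fun i _ => map_smul _ _ _
      rw [clsL_zero, homogeneousComponent_eq_self hh, (kam_iter k _ hh).2, map_sum] at h1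
      simp only [map_smul, Phi_iter] at h1
      have h2 : ∑ i ∈ s, c i • (mono i.1 : P 5) =
          ∑ a ∈ (s.filter fun i => c i ≠ 0).map ⟨Subtype.val, Subtype.val_injective⟩, mono a := by
        rw [Finset.sum_map, Finset.sum_filter]
        refine Finset.sum_congr rfl fun i _ => ?_
        have h2 : ∀ c : ZMod 2, c ≠ 0 → c = 1 := by decide
        split_ifs with h
        · rw [h2 _ h, one_smul]; rfl
        · rw [not_not.1 h, zero_smul]
      rw [h2] at h1
      have h3 := adm_indep _ (by
        intro a ha
        rw [Finset.mem_map] at ha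
        obtain ⟨b, _, rfl⟩ := ha
        exact b.2) h1
      rw [Finset.map_eq_empty] at h3
      have : i ∈ s.filter fun i => c i ≠ 0 := Finset.mem_filter.2 ⟨hi, hci⟩
      rw [h3] at this
      simp at this
    have hr : {x : QP 5 (ee k) | ∃ a : Fin 5 →₀ ℕ,
        degA a = 67 ∧ Admissible a ∧ x = cls 5 (ee k) (Phi^[k] (mono a))} = Set.range w := by
      ext x
      constructor
      · rintro ⟨a, ha, hadm, rfl⟩
        exact ⟨⟨a, ha, hadm⟩, rfl⟩
      · rintro ⟨⟨a, ha, hadm⟩, rfl⟩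
        exact ⟨a, ha, hadm, rfl⟩
    rw [hr]
    exact hw.linearIndepOn_id

/-- for every `s ≥ 3`, the set of classes `[Φ^{s-2}(x)]`, with `x` an
admissible monomial of degree `67` in `P_5`, is a basis of
`(QP_5)_{5(2^s-1)+13·2^s}`. -/
theorem statement8 (s : ℕ) (hs : 3 ≤ s) :
    Submodule.span (ZMod 2)
      {x : QP 5 (5 * (2 ^ s - 1) + 13 * 2 ^ s) | ∃ a : Fin 5 →₀ ℕ,
        degA a = 67 ∧ Admissible a ∧
        x = cls 5 (5 * (2 ^ s - 1) + 13 * 2 ^ s) (Phi^[s - 2] (mono a))} = ⊤ ∧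
    LinearIndependent (ZMod 2)
      (fun x : {x : QP 5 (5 * (2 ^ s - 1) + 13 * 2 ^ s) | ∃ a : Fin 5 →₀ ℕ,
        degA a = 67 ∧ Admissible a ∧
        x = cls 5 (5 * (2 ^ s - 1) + 13 * 2 ^ s) (Phi^[s - 2] (mono a))} =>
        (x : QP 5 (5 * (2 ^ s - 1) + 13 * 2 ^ s))) := by
  refine main (s - 2) _ ?_
  obtain ⟨k, rfl⟩ : ∃ k, s = k + 2 := ⟨s - 2, by omega⟩
  have h1 := ee_eq k
  have h2 : 0 < 2 ^ k := by positivity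
  rw [Nat.add_sub_cancel, pow_add]
  omega

end
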